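/- arXiv:2305.01221 — 3 statements merged into one kernel-verified Lean document; each statement's English description precedes it below -/
import Mathlib

section
/- Let n ≥ 2 and let B be the n×n matrix with entries B_{ij} = min(i,j)·(n+1−max(i,j))/(n+1) (the inverse of the type-A Cartan matrix A_n). For all σ, α ∈ ℝ^{n+1} with ∑_{i∈I} α_i = 0, setting μ_i = 1 + α_i, one has the identity ∑_{i,j=1}^{n} B_{ij} (∑_{t∈I} K_{it} σ_t − 2α_i)(∑_{s∈I} K_{js} σ_s − 2α_j) − 4∑_{i,j=1}^{n} B_{ij} α_i α_j − 4∑_{i∈I} σ_i = ∑_{i=1}^{n+1} (σ_i − σ_{i+1})² − 4∑_{i∈I} μ_i σ_i (with σ_{n+2} = σ_1). In particular the left-hand side vanishes if and only if σ satisfies the type-A Pohozaev identity for μ. -/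
open Finset

/-- The generalized Cartan matrix of type `A_n^{(1)}`, with indices read cyclically
(`K i i = 2`, `K i j = -1` when `i,j` are cyclically adjacent, `0` otherwise). -/
noncomputable def affA (n : ℕ) (i j : ZMod (n + 1)) : ℝ :=
  if i = j then 2 else if i = j + 1 ∨ j = i + 1 then -1 else 0

/-- The 1-based entries of the inverse of the type-A Cartan matrix `A_n`:
`B_{ij} = min(i,j)·(n+1-max(i,j))/(n+1)`. -/
noncomputable def invA (n i j : ℕ) : ℝ :=
  ((min i j : ℕ) : ℝ) * ((n : ℝ) + 1 - ((max i j : ℕ) : ℝ)) / ((n : ℝ) + 1)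

theorem invA_comm (n i j : ℕ) : invA n i j = invA n j i := by
  simp only [invA, min_comm i j, max_comm i j]

/-- The negative second difference of `j ↦ B_{ij}` is the Kronecker delta. -/
theorem invA_second_difference (n i j : ℕ) :
    2 * invA n i (j + 1) - invA n i j - invA n i (j + 2) = if i = j + 1 then 1 else 0 := by
  have hn : (n : ℝ) + 1 ≠ 0 := by positivity
  unfold invA
  rcases lt_trichotomy i (j + 1) with h | h | h
  · rw [if_neg h.ne, min_eq_left (by omega), min_eq_left (by omega), min_eq_left (by omega),
      max_eq_right (by omega), max_eq_right (by omega), max_eq_right (by omega)]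
    push_cast
    field_simp
    ring
  · subst h
    rw [if_pos rfl, min_self, max_self, min_eq_right (by omega), min_eq_left (by omega),
      max_eq_left (by omega), max_eq_right (by omega)]
    push_cast
    field_simp
    ring
  · rw [if_neg h.ne', min_eq_right (by omega), min_eq_right (by omega), min_eq_right (by omega),
      max_eq_left (by omega), max_eq_left (by omega), max_eq_left (by omega)]
    push_cast
    field_simp
    ring

/-- Summation by parts against a row of `B`. -/
theorem sum_range_invA_mul_second_difference (n i m : ℕ) (f : ℕ → ℝ) :
    ∑ j ∈ range m, invA n i (j + 1) * (2 * f (j + 1) - f j - f (j + 2))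
      = ∑ j ∈ range m, (if i = j + 1 then f (j + 1) else 0)
        + (invA n i 0 * f 1 - f 0 * invA n i 1)
        - (invA n i m * f (m + 1) - f m * invA n i (m + 1)) := by
  induction m with
  | zero => simp
  | succ m ih =>
    have h := invA_second_difference n i m
    have h' : (if i = m + 1 then f (m + 1) else 0)
        = f (m + 1) * (if i = m + 1 then (1 : ℝ) else 0) := by split_ifs <;> simp
    rw [sum_range_succ, sum_range_succ, ih, h', ← h]
    ring

theorem sum_Icc_one_eq_sum_range (n : ℕ) (F : ℕ → ℝ) :
    ∑ i ∈ Icc 1 n, F i = ∑ i ∈ range n, F (i + 1) := by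
  rw [range_eq_Ico, sum_Ico_add' F 0 n 1]
  rfl

/-- `B` inverts the second-difference operator on sequences with equal boundary values. -/
theorem sum_invA_mul_second_difference (n i : ℕ) (hi : i ∈ Icc 1 n) (f : ℕ → ℝ)
    (hf : f (n + 1) = f 0) :
    ∑ j ∈ Icc 1 n, invA n i j * (2 * f j - f (j - 1) - f (j + 1)) = f i - f 0 := by
  obtain ⟨h1, h2⟩ := mem_Icc.mp hi
  have hn : (n : ℝ) + 1 ≠ 0 := by positivity
  have hsum : ∑ j ∈ range n, (if i = j + 1 then f (j + 1) else 0) = f i := by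
    rw [← sum_Icc_one_eq_sum_range n fun j => if i = j then f j else 0, sum_ite_eq, if_pos hi]
  have h := sum_range_invA_mul_second_difference n i n f
  rw [hsum, hf] at h
  rw [sum_Icc_one_eq_sum_range]
  refine h.trans ?_
  unfold invA
  rw [min_eq_right (Nat.zero_le i), min_eq_right h1, min_eq_left h2, min_eq_left (by omega),
    max_eq_left (Nat.zero_le i), max_eq_left h1, max_eq_right h2, max_eq_right (by omega)]
  push_cast
  field_simp
  ring

theorem ZMod.sum_univ_eq_zero_add_sum_Icc (n : ℕ) (F : ZMod (n + 1) → ℝ) :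
    ∑ i, F i = F 0 + ∑ i ∈ Icc 1 n, F (i : ZMod (n + 1)) := by
  have h : ∑ i : ZMod (n + 1), F i = ∑ i ∈ range (n + 1), F (i : ZMod (n + 1)) := by
    rw [← Fin.sum_univ_eq_sum_range (fun i => F (i : ZMod (n + 1)))]
    exact sum_congr rfl fun i _ => congrArg F (ZMod.natCast_zmod_val (n := n + 1) i).symm
  rw [h, sum_range_succ', sum_Icc_one_eq_sum_range n fun i => F (i : ZMod (n + 1)), add_comm,
    Nat.cast_zero]

/-- The affine Cartan matrix acts as the cyclic negative second difference. -/
theorem sum_affA_mul (n : ℕ) (hn : 2 ≤ n) (σ : ZMod (n + 1) → ℝ) (i : ZMod (n + 1)) :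
    ∑ t, affA n i t * σ t = 2 * σ i - σ (i - 1) - σ (i + 1) := by
  have h1 : (1 : ZMod (n + 1)) ≠ 0 := by
    intro h
    have h' := (ZMod.natCast_eq_zero_iff 1 (n + 1)).mp (by exact_mod_cast h)
    have := Nat.le_of_dvd one_pos h'
    omega
  have h2 : (2 : ZMod (n + 1)) ≠ 0 := by
    intro h
    have h' := (ZMod.natCast_eq_zero_iff 2 (n + 1)).mp (by exact_mod_cast h)
    have := Nat.le_of_dvd two_pos h'
    omega
  have key : ∀ t, affA n i t * σ t = (if t = i then 2 * σ t else 0)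
      - (if t = i - 1 then σ t else 0) - (if t = i + 1 then σ t else 0) := by
    intro t
    unfold affA
    by_cases ha : t = i
    · subst ha
      have hb : t ≠ t - 1 := fun h => h1 (by linear_combination h)
      simp [h1, hb]
    · by_cases hb : t = i - 1
      · subst hb
        have hc : i - 1 ≠ i + 1 := fun h => h2 (by linear_combination -h)
        simp [h1, hc, Ne.symm ha]
      · have hd : i ≠ t + 1 := fun h => hb (by linear_combination -h)
        simp [ha, Ne.symm ha, hb, hd, neg_ite]
  simp only [key, sum_sub_distrib, sum_ite_eq', mem_univ, if_true]

/-- Expansion of a symmetric double sum, given the action of the kernel on `a`. -/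
theorem sum_sum_mul_sub_two_mul {ι : Type*} (s : Finset ι) (B : ι → ι → ℝ)
    (hB : ∀ i j, B i j = B j i) (a b v : ι → ℝ)
    (hv : ∀ i ∈ s, ∑ j ∈ s, B i j * a j = v i) :
    ∑ i ∈ s, ∑ j ∈ s, B i j * (a i - 2 * b i) * (a j - 2 * b j)
        - 4 * ∑ i ∈ s, ∑ j ∈ s, B i j * b i * b j
      = ∑ i ∈ s, a i * v i - 4 * ∑ i ∈ s, b i * v i := by
  have h1 (c : ι → ℝ) : ∑ i ∈ s, c i * v i = ∑ i ∈ s, ∑ j ∈ s, B i j * c i * a j := by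
    refine sum_congr rfl fun i hi => ?_
    rw [← hv i hi, mul_sum]
    exact sum_congr rfl fun j _ => by ring
  have h2 : ∑ i ∈ s, ∑ j ∈ s, B i j * b i * a j = ∑ i ∈ s, ∑ j ∈ s, B i j * a i * b j := by
    rw [sum_comm]
    exact sum_congr rfl fun i _ => sum_congr rfl fun j _ => by rw [hB j i]; ring
  have h3 : ∑ i ∈ s, ∑ j ∈ s, B i j * (a i - 2 * b i) * (a j - 2 * b j)
      = ∑ i ∈ s, ∑ j ∈ s, B i j * a i * a j - 2 * ∑ i ∈ s, ∑ j ∈ s, B i j * a i * b j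
        - 2 * ∑ i ∈ s, ∑ j ∈ s, B i j * b i * a j
        + 4 * ∑ i ∈ s, ∑ j ∈ s, B i j * b i * b j := by
    simp only [mul_sum, ← sum_sub_distrib, ← sum_add_distrib]
    exact sum_congr rfl fun i _ => sum_congr rfl fun j _ => by ring
  rw [h1, h1, h3, h2]
  ring

/-- For `α` with `∑_{i∈I} α_i = 0` and `μ_i = 1 + α_i`:
`∑_{i,j=1}^n B_{ij}(∑_t K_{it}σ_t - 2α_i)(∑_s K_{js}σ_s - 2α_j) - 4∑_{i,j=1}^n B_{ij}α_iα_j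
  - 4∑_{i∈I} σ_i = ∑_{i=1}^{n+1}(σ_i - σ_{i+1})² - 4∑_{i∈I} μ_i σ_i`,
and in particular the left-hand side vanishes iff `σ` satisfies the type-A Pohozaev
identity for `μ`. -/
theorem invA_pohozaev_identity (n : ℕ) (hn : 2 ≤ n) (σ α μ : ZMod (n + 1) → ℝ)
    (hα : ∑ i : ZMod (n + 1), α i = 0) (hμ : ∀ i, μ i = 1 + α i) :
    (∑ i ∈ Finset.Icc 1 n, ∑ j ∈ Finset.Icc 1 n,
        invA n i j * ((∑ t : ZMod (n + 1), affA n (i : ZMod (n + 1)) t * σ t)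
            - 2 * α (i : ZMod (n + 1))) *
          ((∑ s : ZMod (n + 1), affA n (j : ZMod (n + 1)) s * σ s)
            - 2 * α (j : ZMod (n + 1)))
      - 4 * ∑ i ∈ Finset.Icc 1 n, ∑ j ∈ Finset.Icc 1 n,
          invA n i j * α (i : ZMod (n + 1)) * α (j : ZMod (n + 1))
      - 4 * ∑ i : ZMod (n + 1), σ i
      = ∑ i : ZMod (n + 1), (σ i - σ (i + 1)) ^ 2
        - 4 * ∑ i : ZMod (n + 1), μ i * σ i) ∧
    ((∑ i ∈ Finset.Icc 1 n, ∑ j ∈ Finset.Icc 1 n,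
        invA n i j * ((∑ t : ZMod (n + 1), affA n (i : ZMod (n + 1)) t * σ t)
            - 2 * α (i : ZMod (n + 1))) *
          ((∑ s : ZMod (n + 1), affA n (j : ZMod (n + 1)) s * σ s)
            - 2 * α (j : ZMod (n + 1)))
      - 4 * ∑ i ∈ Finset.Icc 1 n, ∑ j ∈ Finset.Icc 1 n,
          invA n i j * α (i : ZMod (n + 1)) * α (j : ZMod (n + 1))
      - 4 * ∑ i : ZMod (n + 1), σ i = 0) ↔
      ∑ i : ZMod (n + 1), (σ i - σ (i + 1)) ^ 2
        = 4 * ∑ i : ZMod (n + 1), μ i * σ i) := by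
  rw [← sub_eq_zero (b := 4 * ∑ i : ZMod (n + 1), μ i * σ i)]
  suffices h : _ from ⟨h, by rw [h]⟩
  set a : ZMod (n + 1) → ℝ := fun i => ∑ t, affA n i t * σ t with ha
  have ha' (i : ZMod (n + 1)) : a i = 2 * σ i - σ (i - 1) - σ (i + 1) := sum_affA_mul n hn σ i
  have shift (F : ZMod (n + 1) → ℝ) : ∑ i, F (i + 1) = ∑ i, F i :=
    Equiv.sum_comp (Equiv.addRight (1 : ZMod (n + 1))) F
  have shift' (F : ZMod (n + 1) → ℝ) : ∑ i, F (i - 1) = ∑ i, F i :=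
    Equiv.sum_comp (Equiv.subRight (1 : ZMod (n + 1))) F
  have hv : ∀ i ∈ Icc 1 n, ∑ j ∈ Icc 1 n, invA n i j * a (j : ZMod (n + 1))
      = σ (i : ZMod (n + 1)) - σ 0 := by
    intro i hi
    have h := sum_invA_mul_second_difference n i hi (fun j => σ (j : ZMod (n + 1)))
      (by rw [ZMod.natCast_self, Nat.cast_zero])
    rw [Nat.cast_zero] at h
    rw [← h]
    refine sum_congr rfl fun j hj => ?_
    rw [ha', Nat.cast_sub (mem_Icc.mp hj).1, Nat.cast_add, Nat.cast_one]
  have hsum (c : ZMod (n + 1) → ℝ) (hc : ∑ i, c i = 0) :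
      ∑ i ∈ Icc 1 n, c (i : ZMod (n + 1)) * (σ (i : ZMod (n + 1)) - σ 0) = ∑ i, c i * σ i := by
    have h := ZMod.sum_univ_eq_zero_add_sum_Icc n fun i => c i * (σ i - σ 0)
    rw [sub_self, mul_zero, zero_add] at h
    rw [← h]
    simp only [mul_sub, sum_sub_distrib, ← sum_mul, hc, zero_mul, sub_zero]
  have ha0 : ∑ i, a i = 0 := by
    simp only [ha', sum_sub_distrib, ← mul_sum, shift, shift']
    ring
  have hquad : ∑ i, a i * σ i = ∑ i, (σ i - σ (i + 1)) ^ 2 := by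
    have h1 := shift fun i => σ i ^ 2
    have h2 := shift fun i => σ (i - 1) * σ i
    simp only [add_sub_cancel_right] at h2
    have h3 : ∑ i, a i * σ i
        = 2 * ∑ i, σ i ^ 2 - ∑ i, σ (i - 1) * σ i - ∑ i, σ i * σ (i + 1) := by
      simp only [mul_sum, ← sum_sub_distrib]
      exact sum_congr rfl fun i _ => by rw [ha']; ring
    have h4 : ∑ i, (σ i - σ (i + 1)) ^ 2
        = ∑ i, σ i ^ 2 + ∑ i, σ (i + 1) ^ 2 - 2 * ∑ i, σ i * σ (i + 1) := by
      simp only [mul_sum, ← sum_sub_distrib, ← sum_add_distrib]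
      exact sum_congr rfl fun i _ => by ring
    rw [h3, h4]
    linarith
  have hμσ : ∑ i, μ i * σ i = ∑ i, σ i + ∑ i, α i * σ i := by
    simp only [hμ, add_mul, one_mul, sum_add_distrib]
  have hexp := sum_sum_mul_sub_two_mul (Icc 1 n) (invA n) (invA_comm n)
    (fun i => a (i : ZMod (n + 1))) (fun i => α (i : ZMod (n + 1))) _ hv
  rw [hsum a ha0, hsum α hα, hquad] at hexp
  rw [hμσ]
  linarith
end

section
/- Let n ≥ 2 and let m : I → ℕ (indices understood cyclically modulo n+1) satisfy ∑_{i=1}^{n+1} (m_i − m_{i+1})² = 2·m_j for some fixed j ∈ I. Then for every i₀ ∈ I one has m_{i₀} ≤ δ_{i₀ j} + m_{i₀−1} + m_{i₀+1}, where δ_{i₀ j} = 1 if i₀ = j and δ_{i₀ j} = 0 otherwise. -/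
open Finset

theorem abs_sub_le_sum_Ico_sq_sub (f : ℕ → ℤ) {s t : ℕ} (hst : s ≤ t) :
    |f s - f t| ≤ ∑ k ∈ Ico s t, (f k - f (k + 1)) ^ 2 := by
  induction t, hst using Nat.le_induction with
  | base => simp
  | succ t hst ih =>
    rw [sum_Ico_succ_top hst]
    have h₁ := abs_sub_le (f s) (f t) (f (t + 1))
    have h₂ : |f t - f (t + 1)| ≤ (f t - f (t + 1)) ^ 2 := by
      rw [← sq_abs]
      exact Int.le_self_sq _
    linarith

theorem ZMod.sum_eq_sum_range_add {M : Type*} [AddCommMonoid M] (n : ℕ)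
    (g : ZMod (n + 1) → M) (a : ZMod (n + 1)) :
    ∑ i, g i = ∑ k ∈ range (n + 1), g (a + (k : ZMod (n + 1))) := by
  rw [← Equiv.sum_comp (Equiv.addLeft a) g, ← Fin.sum_univ_eq_sum_range]
  refine Finset.sum_congr rfl fun k _ => ?_
  exact congrArg (fun x => g (a + x)) (ZMod.natCast_zmod_val (n := n + 1) k).symm

/-- If `m : I → ℕ` (indices cyclic mod `n+1`) satisfies
`∑_{i=1}^{n+1} (m_i - m_{i+1})² = 2 m_j`, then for every `i₀`,
`m_{i₀} ≤ δ_{i₀ j} + m_{i₀-1} + m_{i₀+1}`. -/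
theorem cyclic_square_sum_neighbor_bound (n : ℕ) (hn : 2 ≤ n) (m : ZMod (n + 1) → ℕ)
    (j : ZMod (n + 1))
    (h : ∑ i : ZMod (n + 1), ((m i : ℤ) - (m (i + 1) : ℤ)) ^ 2 = 2 * (m j : ℤ)) :
    ∀ i₀ : ZMod (n + 1), m i₀ ≤ (if i₀ = j then 1 else 0) + m (i₀ - 1) + m (i₀ + 1) := by
  intro i₀
  set f : ℕ → ℤ := fun k => (m (i₀ + (k : ZMod (n + 1))) : ℤ) with hf
  have hn1 : ((n : ZMod (n + 1)) + 1) = 0 := by exact_mod_cast ZMod.natCast_self (n + 1)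
  have hf0 : f 0 = m i₀ := by simp [hf]
  have hf1 : f 1 = m (i₀ + 1) := by simp [hf]
  have hfn : f n = m (i₀ - 1) := by
    simp only [hf]
    rw [eq_neg_of_add_eq_zero_left hn1, sub_eq_add_neg]
  have hfn1 : f (n + 1) = m i₀ := by
    simp only [hf]
    rw [Nat.cast_succ, hn1, add_zero]
  obtain ⟨t, htn, htj⟩ : ∃ t : ℕ, t ≤ n ∧ i₀ + (t : ZMod (n + 1)) = j :=
    ⟨(j - i₀).val, Nat.lt_succ_iff.mp (ZMod.val_lt _), by
      rw [ZMod.natCast_zmod_val, add_sub_cancel]⟩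
  have hft : f t = m j := by simp only [hf, htj]
  have hsum : (f 0 - f 1) ^ 2 + ∑ k ∈ Ico 1 n, (f k - f (k + 1)) ^ 2
      + (f n - f (n + 1)) ^ 2 = 2 * f t := by
    rw [hft, ← h, ZMod.sum_eq_sum_range_add n _ i₀, sum_range_succ, range_eq_Ico,
      sum_eq_sum_Ico_succ_bot (by omega : 0 < n)]
    simp [hf, add_assoc]
  by_contra! hlt
  have ha : 0 ≤ f n := by rw [hfn]; positivity
  have hb : 0 ≤ f 1 := by rw [hf1]; positivity
  rw [hfn1, ← hf0] at hsum
  by_cases hij : i₀ = j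
  · rw [if_pos hij] at hlt
    have hlt' : 1 + f n + f 1 < f 0 := by rw [hf0, hf1, hfn]; exact_mod_cast hlt
    have hmid : 0 ≤ ∑ k ∈ Ico 1 n, (f k - f (k + 1)) ^ 2 := sum_nonneg fun _ _ => sq_nonneg _
    rw [hft, ← hij, ← hf0] at hsum
    nlinarith [sq_nonneg (f n - f 1), sq_nonneg (f 0 - f 1 - 2), sq_nonneg (f 0 - f n - 2)]
  · rw [if_neg hij] at hlt
    have hlt' : f n + f 1 < f 0 := by rw [hf0, hf1, hfn]; exact_mod_cast (zero_add (m _) ▸ hlt)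
    have ht : 1 ≤ t := by
      rcases Nat.eq_zero_or_pos t with rfl | ht
      · exact absurd (by simpa using htj) hij
      · exact ht
    rw [← sum_Ico_consecutive _ ht htn] at hsum
    have h₁ := (neg_le_abs _).trans (abs_sub_le_sum_Ico_sq_sub f ht)
    have h₂ := (le_abs_self _).trans (abs_sub_le_sum_Ico_sq_sub f htn)
    nlinarith [Int.le_self_sq (f 0 - f 1), Int.le_self_sq (f n - f 0),
      Int.le_self_sq (f 0 - f n)]
end

section
/- Let n ≥ 2, μ, σ ∈ ℝ^{n+1}, and let 2 ≤ i ≤ n+1; set l = n+1−i. Consider the composition W = ℜ_iℜ_{i+1}⋯ℜ_{n+1} (rightmost applied first). Then (W^{l+1}σ)_s = σ_s for 1 ≤ s ≤ i−1, and for i ≤ s ≤ n+1: (W^{l+1}σ)_s = 4∑_{q=i}^{s} ∑_{t=q}^{n+1} μ_t − 2(s−i+1)μ_{n+1} − σ_s + 2σ_{i−1}. -/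
open Finset

/-- The generalized Cartan matrix `K^c` of type `C_n^{(1),t}` (1-based indices in
`{1,…,n+1}`): `K^c_{ii} = 2`, `K^c_{1,2} = K^c_{n+1,n} = -2`,
`K^c_{i,i-1} = K^c_{i,i+1} = -1` for `2 ≤ i ≤ n`, and `0` otherwise. -/
noncomputable def affC (n : ℕ) (i j : ℕ) : ℝ :=
  if i = j then 2
  else if (i = 1 ∧ j = 2) ∨ (i = n + 1 ∧ j = n) then -2
  else if 2 ≤ i ∧ i ≤ n ∧ (j = i - 1 ∨ j = i + 1) then -1
  else 0

/-- The affine reflection `ℜ_i` associated to `μ`: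
`(ℜ_i σ)_i = 2 μ_i - ∑_{t∈I} K^c_{it} σ_t + σ_i`, other coordinates unchanged. -/
noncomputable def reflC (n : ℕ) (μ : ℕ → ℝ) (i : ℕ) (σ : ℕ → ℝ) : ℕ → ℝ :=
  Function.update σ i
    (2 * μ i - ∑ t ∈ Finset.Icc 1 (n + 1), affC n i t * σ t + σ i)

/-- `downChain R b k` applies `R b, R (b-1), …, R (b-k+1)` in this order
(i.e. `R b` first). -/
def downChain {α : Type*} (R : ℕ → α → α) : ℕ → ℕ → α → α
  | _, 0, σ => σ
  | b, k + 1, σ => downChain R (b - 1) k (R b σ)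

theorem reflC_of_ne (n : ℕ) (μ σ : ℕ → ℝ) {i s : ℕ} (h : s ≠ i) :
    reflC n μ i σ s = σ s := by
  simp [reflC, h]

theorem reflC_last (n : ℕ) (hn : 2 ≤ n) (μ σ : ℕ → ℝ) :
    reflC n μ (n + 1) σ (n + 1) = 2 * μ (n + 1) + 2 * σ n - σ (n + 1) := by
  have h : ∑ t ∈ Finset.Icc 1 (n + 1), affC n (n + 1) t * σ t
      = ∑ t ∈ ({n, n + 1} : Finset ℕ), affC n (n + 1) t * σ t := by
    symm
    apply Finset.sum_subset
    · intro t ht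
      simp only [Finset.mem_insert, Finset.mem_singleton, Finset.mem_Icc] at ht ⊢
      omega
    · intro t _ ht
      simp only [Finset.mem_insert, Finset.mem_singleton] at ht
      rw [affC, if_neg (by omega), if_neg (by omega), if_neg (by omega), zero_mul]
  have h1 : affC n (n + 1) n = -2 := by
    rw [affC, if_neg (by omega), if_pos (by omega)]
  have h2 : affC n (n + 1) (n + 1) = 2 := by rw [affC, if_pos rfl]
  rw [reflC, Function.update_self, h, Finset.sum_pair (by omega), h1, h2]
  ring

theorem reflC_middle (n : ℕ) (μ σ : ℕ → ℝ) (i : ℕ) (hi1 : 2 ≤ i) (hi2 : i ≤ n) :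
    reflC n μ i σ i = 2 * μ i + σ (i - 1) + σ (i + 1) - σ i := by
  have h : ∑ t ∈ Finset.Icc 1 (n + 1), affC n i t * σ t
      = ∑ t ∈ ({i - 1, i, i + 1} : Finset ℕ), affC n i t * σ t := by
    symm
    apply Finset.sum_subset
    · intro t ht
      simp only [Finset.mem_insert, Finset.mem_singleton, Finset.mem_Icc] at ht ⊢
      omega
    · intro t _ ht
      simp only [Finset.mem_insert, Finset.mem_singleton] at ht
      rw [affC, if_neg (by omega), if_neg (by omega), if_neg (by omega), zero_mul]
  have h1 : affC n i (i - 1) = -1 := by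
    rw [affC, if_neg (by omega), if_neg (by omega), if_pos (by omega)]
  have h2 : affC n i i = 2 := by rw [affC, if_pos rfl]
  have h3 : affC n i (i + 1) = -1 := by
    rw [affC, if_neg (by omega), if_neg (by omega), if_pos (by omega)]
  rw [reflC, Function.update_self, h, Finset.sum_insert (by simp; omega),
    Finset.sum_pair (by omega), h1, h2, h3]
  ring

theorem downChain_succ {α : Type*} (R : ℕ → α → α) (b k : ℕ) (σ : α) :
    downChain R b (k + 1) σ = R (b - k) (downChain R b k σ) := by
  induction k generalizing b σ with
  | zero => rfl
  | succ k ih =>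
    rw [downChain, ih, show b - 1 - k = b - (k + 1) by omega]
    rfl

theorem downChain_reflC (n : ℕ) (hn : 2 ≤ n) (μ σ : ℕ → ℝ) (k : ℕ) (hk : k + 1 ≤ n) :
    (∀ s, s + k ≤ n → downChain (reflC n μ) (n + 1) (k + 1) σ s = σ s) ∧
    (∀ s, n + 1 ≤ s + k → s ≤ n + 1 → downChain (reflC n μ) (n + 1) (k + 1) σ s =
      2 * ∑ t ∈ Finset.Icc s (n + 1), μ t + σ (s - 1) + σ n - σ (n + 1)) := by
  induction k with
  | zero =>
    refine ⟨fun s hs => reflC_of_ne _ _ _ (by omega), fun s h1 h2 => ?_⟩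
    obtain rfl : s = n + 1 := by omega
    rw [downChain, downChain, reflC_last n hn]
    simp only [Finset.Icc_self, Finset.sum_singleton, Nat.add_sub_cancel]
    ring
  | succ k ih =>
    obtain ⟨ih1, ih2⟩ := ih (by omega)
    simp only [downChain_succ _ _ (k + 1)]
    refine ⟨fun s hs => ?_, fun s h1 h2 => ?_⟩
    · rw [reflC_of_ne _ _ _ (by omega), ih1 s (by omega)]
    · by_cases hs : s = n + 1 - (k + 1)
      · rw [← hs, reflC_middle _ _ _ _ (by omega) (by omega), ih1 s (by omega),
          ih1 (s - 1) (by omega), ih2 (s + 1) (by omega) (by omega),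
          ← Finset.add_sum_Ioc_eq_sum_Icc h2, Nat.add_sub_cancel,
          ← Finset.Icc_add_one_left_eq_Ioc]
        ring
      · rw [reflC_of_ne _ _ _ hs, ih2 s (by omega) h2]

/-- The coordinates in which a descending chain of reflections acts as a signed cyclic shift. -/
noncomputable def shiftCoord (n : ℕ) (μ σ : ℕ → ℝ) (j : ℕ) : ℝ :=
  σ j - σ (j - 1) - 2 * ∑ t ∈ Finset.Icc j (n + 1), μ t

theorem shiftCoord_downChain_succ (n : ℕ) (hn : 2 ≤ n) (μ σ : ℕ → ℝ) (k : ℕ) (hk : k + 1 ≤ n)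
    (j : ℕ) (hj1 : n + 1 ≤ j + k) (hj2 : j ≤ n) :
    shiftCoord n μ (downChain (reflC n μ) (n + 1) (k + 1) σ) (j + 1) = shiftCoord n μ σ j := by
  obtain ⟨-, h⟩ := downChain_reflC n hn μ σ k hk
  simp only [shiftCoord, Nat.add_sub_cancel]
  rw [h (j + 1) (by omega) (by omega), h j hj1 (by omega), Nat.add_sub_cancel]
  ring

theorem shiftCoord_downChain_first (n : ℕ) (hn : 2 ≤ n) (μ σ : ℕ → ℝ) (k : ℕ) (hk : k + 1 ≤ n)
    (j : ℕ) (hj : j + k = n + 1) :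
    shiftCoord n μ (downChain (reflC n μ) (n + 1) (k + 1) σ) j =
      -shiftCoord n μ σ (n + 1) - 2 * μ (n + 1) := by
  obtain ⟨h1, h2⟩ := downChain_reflC n hn μ σ k hk
  simp only [shiftCoord]
  rw [h2 j (by omega) (by omega), h1 (j - 1) (by omega)]
  simp only [Finset.Icc_self, Finset.sum_singleton, Nat.add_sub_cancel]
  ring

theorem iterate_downChain_of_le (n : ℕ) (hn : 2 ≤ n) (μ σ : ℕ → ℝ) (k : ℕ) (hk : k + 1 ≤ n)
    (m s : ℕ) (hs : s + k ≤ n) :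
    (downChain (reflC n μ) (n + 1) (k + 1))^[m] σ s = σ s := by
  induction m with
  | zero => rfl
  | succ m ih =>
    rw [Function.iterate_succ_apply', (downChain_reflC n hn μ _ k hk).1 s hs, ih]

theorem shiftCoord_iterate (n : ℕ) (hn : 2 ≤ n) (μ σ : ℕ → ℝ) (k : ℕ) (hk : k + 1 ≤ n)
    (m : ℕ) (hm : m ≤ k + 1) (j p : ℕ) (hj1 : n + 1 ≤ j + k) (hj2 : j ≤ n + 1)
    (hp1 : n + 1 ≤ p + k) (hp2 : p ≤ n + 1) :
    (p = j + m → shiftCoord n μ ((downChain (reflC n μ) (n + 1) (k + 1))^[m] σ) p =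
      shiftCoord n μ σ j) ∧
    (p + (k + 1) = j + m → shiftCoord n μ ((downChain (reflC n μ) (n + 1) (k + 1))^[m] σ) p =
      -shiftCoord n μ σ j - 2 * μ (n + 1)) := by
  induction m generalizing p with
  | zero =>
    refine ⟨fun h => by rw [h]; rfl, fun h => by omega⟩
  | succ m ih =>
    simp only [Function.iterate_succ_apply']
    refine ⟨fun h => ?_, fun h => ?_⟩
    · subst h
      rw [← add_assoc, shiftCoord_downChain_succ n hn μ _ k hk _ (by omega) (by omega)]
      exact (ih (by omega) (j + m) (by omega) (by omega)).1 rfl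
    · by_cases hp : p + k = n + 1
      · rw [shiftCoord_downChain_first n hn μ _ k hk p hp,
          (ih (by omega) (n + 1) (by omega) le_rfl).1 (by omega)]
      · obtain ⟨q, rfl⟩ : ∃ q, p = q + 1 := ⟨p - 1, by omega⟩
        rw [shiftCoord_downChain_succ n hn μ _ k hk q (by omega) (by omega)]
        exact (ih (by omega) q (by omega) (by omega)).2 (by omega)

/-- The explicit formula for `W^{l+1} σ`, with `l = n+1-i` and
`W = ℜ_iℜ_{i+1}⋯ℜ_{n+1}` (rightmost applied first, i.e. `ℜ_{n+1}` first then
descending to `ℜ_i`; note `l + 1 = n+1-i+1` applications). -/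
theorem chainC_high_formula (n : ℕ) (hn : 2 ≤ n) (μ σ : ℕ → ℝ) (i : ℕ)
    (hi1 : 2 ≤ i) (hi2 : i ≤ n + 1) :
    (∀ s : ℕ, 1 ≤ s → s ≤ i - 1 →
      (downChain (reflC n μ) (n + 1) (n + 1 - i + 1))^[n + 1 - i + 1] σ s = σ s) ∧
    (∀ s : ℕ, i ≤ s → s ≤ n + 1 →
      (downChain (reflC n μ) (n + 1) (n + 1 - i + 1))^[n + 1 - i + 1] σ s =
        4 * ∑ q ∈ Finset.Icc i s, ∑ t ∈ Finset.Icc q (n + 1), μ t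
          - 2 * ((s - i + 1 : ℕ) : ℝ) * μ (n + 1) - σ s + 2 * σ (i - 1)) := by
  have hk : n + 1 - i + 1 ≤ n := by omega
  have hlow := iterate_downChain_of_le n hn μ σ (n + 1 - i) hk (n + 1 - i + 1)
  have hstep := fun j (h1 : i ≤ j) (h2 : j ≤ n + 1) =>
    (shiftCoord_iterate n hn μ σ (n + 1 - i) hk (n + 1 - i + 1) le_rfl j j
      (by omega) h2 (by omega) h2).2 rfl
  generalize (downChain (reflC n μ) (n + 1) (n + 1 - i + 1))^[n + 1 - i + 1] σ = τ at *
  simp only [shiftCoord] at hstep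
  refine ⟨fun s _ hs => hlow s (by omega), fun s hs => ?_⟩
  induction s, hs using Nat.le_induction with
  | base =>
    intro h
    have h1 := hstep i le_rfl h
    have h2 := hlow (i - 1) (by omega)
    simp only [Finset.Icc_self, Finset.sum_singleton, Nat.sub_self, zero_add, Nat.cast_one]
    linarith
  | succ s hs ih =>
    intro h
    have h1 := hstep (s + 1) (by omega) h
    have h2 := ih (by omega)
    rw [Finset.sum_Icc_succ_top (by omega), show s + 1 - i + 1 = (s - i + 1) + 1 by omega,
      Nat.cast_add_one (s - i + 1)]
    rw [Nat.add_sub_cancel] at h1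
    linarith
end
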